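/- arXiv:2509.12434 — 6 statements merged into one kernel-verified Lean document; each statement's English description precedes it below -/
import Mathlib

section
/- Let Y be a finite nonempty set, π_ref a probability distribution on Y with π_ref(y) > 0 for all y ∈ Y, u : Y → ℝ, and real constants α > 0 and β ≥ 0. Set Z = Σ_{y∈Y} π_ref(y)^{β/α} · exp(u(y)/α) and π(y) = π_ref(y)^{β/α} · exp(u(y)/α) / Z. Then for all y, y' ∈ Y: u(y) − u(y') = α · log(π(y)/π(y')) − β · log(π_ref(y)/π_ref(y')). -/
theorem stmt_4 {Y : Type*} [Fintype Y] [Nonempty Y]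
    (piRef : Y → ℝ) (hrefpos : ∀ y, 0 < piRef y) (hrefsum : ∑ y, piRef y = 1)
    (u : Y → ℝ) (α β : ℝ) (hα : 0 < α) (hβ : 0 ≤ β)
    (Z : ℝ) (hZ : Z = ∑ y, piRef y ^ (β / α) * Real.exp (u y / α))
    (pol : Y → ℝ)
    (hpol : ∀ y, pol y = piRef y ^ (β / α) * Real.exp (u y / α) / Z) :
    ∀ y y' : Y,
      u y - u y' =
        α * Real.log (pol y / pol y') - β * Real.log (piRef y / piRef y') := by
  have hw : ∀ y, 0 < piRef y ^ (β / α) * Real.exp (u y / α) := fun y =>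
    mul_pos (Real.rpow_pos_of_pos (hrefpos y) _) (Real.exp_pos _)
  have hZpos : 0 < Z := hZ ▸ Finset.sum_pos (fun y _ => hw y) Finset.univ_nonempty
  have hlog : ∀ y, Real.log (pol y) = β / α * Real.log (piRef y) + u y / α - Real.log Z := by
    intro y
    rw [hpol, Real.log_div (hw y).ne' hZpos.ne',
      Real.log_mul (Real.rpow_pos_of_pos (hrefpos y) _).ne' (Real.exp_pos _).ne',
      Real.log_rpow (hrefpos y), Real.log_exp]
  have hpolne : ∀ y, pol y ≠ 0 := fun y => by
    rw [hpol]
    exact (div_pos (hw y) hZpos).ne'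
  intro y y'
  rw [Real.log_div (hpolne y) (hpolne y'), Real.log_div (hrefpos y).ne' (hrefpos y').ne',
    hlog, hlog]
  field_simp
  ring
end

section
/- Let Y be a finite nonempty set, π_ref a probability distribution on Y with π_ref(y) > 0 for all y ∈ Y, u : Y → ℝ, and real constants α > 0 and β ≥ 0. Set Z = Σ_{y∈Y} π_ref(y)^{β/α} · exp(u(y)/α) and π(y) = π_ref(y)^{β/α} · exp(u(y)/α) / Z. Then for all y⁺, y⁻ ∈ Y: σ(u(y⁺) − u(y⁻)) = σ( α · [ log(π(y⁺)/π_ref(y⁺)^{β/α}) − log(π(y⁻)/π_ref(y⁻)^{β/α}) ] ), where σ(t) = 1/(1 + exp(−t)) is the logistic sigmoid. -/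
/-- The logistic sigmoid `σ(t) = 1 / (1 + exp (−t))`. -/
noncomputable def sigmoid (t : ℝ) : ℝ := 1 / (1 + Real.exp (-t))

theorem stmt_6 {Y : Type*} [Fintype Y] [Nonempty Y]
    (piRef : Y → ℝ) (hrefpos : ∀ y, 0 < piRef y) (hrefsum : ∑ y, piRef y = 1)
    (u : Y → ℝ) (α β : ℝ) (hα : 0 < α) (hβ : 0 ≤ β)
    (Z : ℝ) (hZ : Z = ∑ y, piRef y ^ (β / α) * Real.exp (u y / α))
    (pol : Y → ℝ)
    (hpol : ∀ y, pol y = piRef y ^ (β / α) * Real.exp (u y / α) / Z) :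
    ∀ yp ym : Y,
      sigmoid (u yp - u ym) =
        sigmoid (α * (Real.log (pol yp / piRef yp ^ (β / α)) -
          Real.log (pol ym / piRef ym ^ (β / α)))) := by
  have hZpos : 0 < Z := by
    rw [hZ]
    exact Finset.sum_pos
      (fun y _ => mul_pos (Real.rpow_pos_of_pos (hrefpos y) _) (Real.exp_pos _))
      Finset.univ_nonempty
  have hlog (y : Y) : Real.log (pol y / piRef y ^ (β / α)) = u y / α - Real.log Z := by
    have hpow : piRef y ^ (β / α) ≠ 0 := (Real.rpow_pos_of_pos (hrefpos y) _).ne'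
    rw [hpol, div_right_comm, mul_div_cancel_left₀ _ hpow,
      Real.log_div (Real.exp_ne_zero _) hZpos.ne', Real.log_exp]
  intro yp ym
  rw [hlog, hlog, sub_sub_sub_cancel_right, ← sub_div, mul_div_cancel₀ _ hα.ne']
end

section
/- In the finite-horizon entropy-regularized setup with H = 2, fix an initial state s_1 ∈ S_1. For any pair of policies ρ_1, ρ_2 (where ρ_h(·|s) is a probability distribution on A for every state s), define J(ρ_1, ρ_2) = Σ_{a_1∈A} ρ_1(a_1|s_1) · Σ_{o∈O} P_1(o|s_1,a_1) · [ Σ_{a_2∈A} ρ_2(a_2|s_2) u(s_2, a_2) + α H(ρ_2(·|s_2)) − β H(ρ_2(·|s_2), π_ref,2(·|s_2)) ] + α H(ρ_1(·|s_1)) − β H(ρ_1(·|s_1), π_ref,1(·|s_1)), where s_2 = T_1(s_1, a_1, o). Then J(ρ_1, ρ_2) ≤ α log Z_1(s_1) for all ρ_1, ρ_2, and equality holds for ρ_1 = π_1, ρ_2 = π_2. -/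
/-- Shannon entropy of a distribution on a finite type (with `0 * log 0 = 0`). -/
noncomputable def Hent {Ω : Type*} [Fintype Ω] (p : Ω → ℝ) : ℝ :=
  -∑ w, p w * Real.log (p w)

/-- Cross-entropy `H(p, q)`. -/
noncomputable def Hcross {Ω : Type*} [Fintype Ω] (p q : Ω → ℝ) : ℝ :=
  -∑ w, p w * Real.log (q w)

/-- Log-sum inequality against a positive weight `w`: the Gibbs variational bound. -/
theorem sum_mul_log_sub_log_le {A : Type*} [Fintype A] [Nonempty A] {p w : A → ℝ}
    (hw : ∀ a, 0 < w a) (hp : ∀ a, 0 ≤ p a) (hsum : ∑ a, p a = 1) :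
    ∑ a, p a * (Real.log (w a) - Real.log (p a)) ≤ Real.log (∑ a, w a) := by
  set Z := ∑ a, w a with hZ
  have hZpos : 0 < Z := Finset.sum_pos (fun a _ => hw a) Finset.univ_nonempty
  have key : ∀ a, p a * (Real.log (w a) - Real.log (p a)) ≤
      p a * Real.log Z + w a / Z - p a := by
    intro a
    rcases (hp a).eq_or_lt with h | h
    · simpa [← h] using (div_pos (hw a) hZpos).le
    · have hlog := Real.log_le_sub_one_of_pos (div_pos (hw a) (mul_pos h hZpos))
      rw [Real.log_div (hw a).ne' (mul_pos h hZpos).ne', Real.log_mul h.ne' hZpos.ne'] at hlog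
      have hmul := mul_le_mul_of_nonneg_left hlog h.le
      have hdiv : p a * (w a / (p a * Z) - 1) = w a / Z - p a := by
        field_simp
      linarith
  calc ∑ a, p a * (Real.log (w a) - Real.log (p a))
      ≤ ∑ a, (p a * Real.log Z + w a / Z - p a) := Finset.sum_le_sum fun a _ => key a
    _ = Real.log Z := by
      rw [Finset.sum_sub_distrib, Finset.sum_add_distrib, ← Finset.sum_mul, ← Finset.sum_div,
        hsum, ← hZ, div_self hZpos.ne']
      ring

/-- The one-step regularized objective as a relative-entropy expression in the Gibbs weights. -/
theorem regularized_objective_eq {A : Type*} [Fintype A] {r : A → ℝ} (hr : ∀ a, 0 < r a)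
    {α : ℝ} (hα : α ≠ 0) (β : ℝ) (q p : A → ℝ) :
    ∑ a, p a * q a + α * Hent p - β * Hcross p r =
      α * ∑ a, p a *
        (Real.log (r a ^ (β / α) * Real.exp (q a / α)) - Real.log (p a)) := by
  simp only [Hent, Hcross, mul_neg, sub_neg_eq_add, Finset.mul_sum, ← sub_eq_add_neg]
  rw [← Finset.sum_sub_distrib, ← Finset.sum_add_distrib]
  refine Finset.sum_congr rfl fun a _ => ?_
  rw [Real.log_mul (Real.rpow_pos_of_pos (hr a) _).ne' (Real.exp_pos _).ne', Real.log_exp,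
    Real.log_rpow (hr a)]
  field_simp
  ring

theorem gibbs_weight_pos {A : Type*} {r : A → ℝ} (hr : ∀ a, 0 < r a) (α β : ℝ) (q : A → ℝ)
    (a : A) : 0 < r a ^ (β / α) * Real.exp (q a / α) :=
  mul_pos (Real.rpow_pos_of_pos (hr a) _) (Real.exp_pos _)

theorem regularized_objective_le {A : Type*} [Fintype A] [Nonempty A] {r : A → ℝ}
    (hr : ∀ a, 0 < r a) {α : ℝ} (hα : 0 < α) (β : ℝ) (q : A → ℝ) {p : A → ℝ}
    (hp : ∀ a, 0 ≤ p a) (hsum : ∑ a, p a = 1) :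
    ∑ a, p a * q a + α * Hent p - β * Hcross p r ≤
      α * Real.log (∑ a, r a ^ (β / α) * Real.exp (q a / α)) := by
  rw [regularized_objective_eq hr hα.ne']
  exact mul_le_mul_of_nonneg_left
    (sum_mul_log_sub_log_le (gibbs_weight_pos hr α β q) hp hsum) hα.le

theorem regularized_objective_gibbs {A : Type*} [Fintype A] [Nonempty A] {r : A → ℝ}
    (hr : ∀ a, 0 < r a) {α : ℝ} (hα : α ≠ 0) (β : ℝ) (q : A → ℝ) {p : A → ℝ} {Z : ℝ}
    (hZ : Z = ∑ a, r a ^ (β / α) * Real.exp (q a / α))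
    (hp : ∀ a, p a = r a ^ (β / α) * Real.exp (q a / α) / Z) :
    ∑ a, p a * q a + α * Hent p - β * Hcross p r = α * Real.log Z := by
  have hw := gibbs_weight_pos hr α β q
  have hZpos : 0 < Z := hZ ▸ Finset.sum_pos (fun a _ => hw a) Finset.univ_nonempty
  have hlog : ∀ a, Real.log (r a ^ (β / α) * Real.exp (q a / α)) - Real.log (p a) =
      Real.log Z := fun a => by
    rw [hp, Real.log_div (hw a).ne' hZpos.ne', sub_sub_cancel]
  have hsum : ∑ a, p a = 1 := by
    simp_rw [hp]
    rw [← Finset.sum_div, ← hZ, div_self hZpos.ne']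
  rw [regularized_objective_eq hr hα]
  simp_rw [hlog]
  rw [← Finset.sum_mul, hsum, one_mul]

/-
The finite-horizon entropy-regularized setup with `H = 2`:
state sets `S1, S2`, actions `A`, observations `O`, transition `T`,
observation kernel `P` at step 1, reference policies `piRef1, piRef2`,
terminal utility `u`, and the backward-induction quantities
`Q2, Z2, pol2, V2` (step 2) and `Q1, Z1, pol1, V1` (step 1),
characterized by their defining equations given as hypotheses.
-/
theorem stmt_9 {S1 S2 : Type*} [Fintype S1] [Nonempty S1] [Fintype S2] [Nonempty S2]
    {A : Type*} [Fintype A] [Nonempty A]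
    {O : Type*} [Fintype O] [Nonempty O]
    (T : S1 → A → O → S2)
    (P : S1 → A → O → ℝ)
    (hPpos : ∀ s a o, 0 ≤ P s a o) (hPsum : ∀ s a, ∑ o, P s a o = 1)
    (piRef1 : S1 → A → ℝ) (href1pos : ∀ s a, 0 < piRef1 s a)
    (href1sum : ∀ s, ∑ a, piRef1 s a = 1)
    (piRef2 : S2 → A → ℝ) (href2pos : ∀ s a, 0 < piRef2 s a)
    (href2sum : ∀ s, ∑ a, piRef2 s a = 1)
    (u : S2 → A → ℝ)
    (α β : ℝ) (hα : 0 < α) (hβ : 0 ≤ β)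
    (Q2 : S2 → A → ℝ) (hQ2 : ∀ s a, Q2 s a = u s a)
    (Z2 : S2 → ℝ)
    (hZ2 : ∀ s, Z2 s = ∑ a, piRef2 s a ^ (β / α) * Real.exp (Q2 s a / α))
    (pol2 : S2 → A → ℝ)
    (hpol2 : ∀ s a, pol2 s a = piRef2 s a ^ (β / α) * Real.exp (Q2 s a / α) / Z2 s)
    (V2 : S2 → ℝ) (hV2 : ∀ s, V2 s = α * Real.log (Z2 s))
    (Q1 : S1 → A → ℝ) (hQ1 : ∀ s a, Q1 s a = ∑ o, P s a o * V2 (T s a o))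
    (Z1 : S1 → ℝ)
    (hZ1 : ∀ s, Z1 s = ∑ a, piRef1 s a ^ (β / α) * Real.exp (Q1 s a / α))
    (pol1 : S1 → A → ℝ)
    (hpol1 : ∀ s a, pol1 s a = piRef1 s a ^ (β / α) * Real.exp (Q1 s a / α) / Z1 s)
    (V1 : S1 → ℝ) (hV1 : ∀ s, V1 s = α * Real.log (Z1 s))
    -- the fixed initial state and the two-step objective `J`
    (s1 : S1)
    (J : (S1 → A → ℝ) → (S2 → A → ℝ) → ℝ)
    (hJ : ∀ ρ1 ρ2, J ρ1 ρ2 =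
      ∑ a1, ρ1 s1 a1 * ∑ o, P s1 a1 o *
          (∑ a2, ρ2 (T s1 a1 o) a2 * u (T s1 a1 o) a2
            + α * Hent (ρ2 (T s1 a1 o))
            - β * Hcross (ρ2 (T s1 a1 o)) (piRef2 (T s1 a1 o)))
        + α * Hent (ρ1 s1) - β * Hcross (ρ1 s1) (piRef1 s1)) :
    (∀ ρ1 : S1 → A → ℝ, ∀ ρ2 : S2 → A → ℝ,
      (∀ s a, 0 ≤ ρ1 s a) → (∀ s, ∑ a, ρ1 s a = 1) →
      (∀ s a, 0 ≤ ρ2 s a) → (∀ s, ∑ a, ρ2 s a = 1) →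
      J ρ1 ρ2 ≤ α * Real.log (Z1 s1)) ∧
    J pol1 pol2 = α * Real.log (Z1 s1) := by
  constructor
  · intro ρ1 ρ2 hρ1 hρ1sum hρ2 hρ2sum
    have hstep2 : ∀ s, ∑ a, ρ2 s a * u s a + α * Hent (ρ2 s) - β * Hcross (ρ2 s) (piRef2 s) ≤
        V2 s := fun s => by
      rw [hV2, hZ2]
      simp_rw [hQ2]
      exact regularized_objective_le (href2pos s) hα β (u s) (hρ2 s) (hρ2sum s)
    have hstep1 := regularized_objective_le (href1pos s1) hα β (Q1 s1) (hρ1 s1) (hρ1sum s1)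
    rw [← hZ1] at hstep1
    refine le_trans ?_ hstep1
    rw [hJ]
    gcongr with a _
    · exact hρ1 s1 a
    rw [hQ1]
    gcongr with o _
    · exact hPpos s1 a o
    exact hstep2 _
  · have hstep2 : ∀ s, ∑ a, pol2 s a * u s a + α * Hent (pol2 s)
        - β * Hcross (pol2 s) (piRef2 s) = V2 s := fun s => by
      rw [hV2]
      simp_rw [← hQ2]
      exact regularized_objective_gibbs (href2pos s) hα.ne' β (Q2 s) (hZ2 s) (hpol2 s)
    rw [hJ]
    simp_rw [hstep2, ← hQ1]
    exact regularized_objective_gibbs (href1pos s1) hα.ne' β (Q1 s1) (hZ1 s1) (hpol1 s1)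
end

section
/- In the finite-horizon entropy-regularized setup, for every trajectory (s_1, a_1, o_1, s_2, a_2, o_2, …, s_H, a_H) with s_h ∈ S_h, a_h ∈ A, o_h ∈ O and s_{h+1} = T_h(s_h, a_h, o_h) for 1 ≤ h ≤ H−1, the following identity holds: u(s_H, a_H) = α · Σ_{h=1}^{H} log( π_h(a_h|s_h) / π_ref,h(a_h|s_h)^{β/α} ) + V_1(s_1) + Σ_{h=1}^{H−1} [ V_{h+1}(s_{h+1}) − Σ_{o∈O} P_h(o|s_h,a_h) · V_{h+1}(T_h(s_h,a_h,o)) ]. -/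
/-
Finite-horizon entropy-regularized setup with horizon `H = N + 1 ≥ 1`:
states `S h` for `h : Fin (N+1)`, actions `A`, observations `O`,
transitions `T`, observation kernels `P`, reference policies `piRef`,
terminal utility `u`, and the backward-induction quantities
`Q`, `Z`, `pol` (the optimal policy) and `V`, characterized by their
defining equations given as hypotheses.
-/
theorem stmt_11 {N : ℕ}
    {S : Fin (N + 1) → Type*} [∀ h, Fintype (S h)] [∀ h, Nonempty (S h)]
    {A : Type*} [Fintype A] [Nonempty A]
    {O : Type*} [Fintype O] [Nonempty O]
    (T : ∀ h : Fin N, S h.castSucc → A → O → S h.succ)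
    (P : ∀ h : Fin N, S h.castSucc → A → O → ℝ)
    (hPpos : ∀ h s a o, 0 ≤ P h s a o)
    (hPsum : ∀ h s a, ∑ o, P h s a o = 1)
    (piRef : ∀ h : Fin (N + 1), S h → A → ℝ)
    (hrefpos : ∀ h s a, 0 < piRef h s a)
    (hrefsum : ∀ h s, ∑ a, piRef h s a = 1)
    (u : S (Fin.last N) → A → ℝ)
    (α β : ℝ) (hα : 0 < α) (hβ : 0 ≤ β)
    (Q : ∀ h : Fin (N + 1), S h → A → ℝ)
    (Z : ∀ h : Fin (N + 1), S h → ℝ)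
    (pol : ∀ h : Fin (N + 1), S h → A → ℝ)
    (V : ∀ h : Fin (N + 1), S h → ℝ)
    (hQlast : ∀ s a, Q (Fin.last N) s a = u s a)
    (hQ : ∀ (h : Fin N) (s : S h.castSucc) (a : A),
      Q h.castSucc s a = ∑ o, P h s a o * V h.succ (T h s a o))
    (hZ : ∀ (h : Fin (N + 1)) (s : S h),
      Z h s = ∑ a, piRef h s a ^ (β / α) * Real.exp (Q h s a / α))
    (hpol : ∀ (h : Fin (N + 1)) (s : S h) (a : A),
      pol h s a = piRef h s a ^ (β / α) * Real.exp (Q h s a / α) / Z h s)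
    (hV : ∀ (h : Fin (N + 1)) (s : S h), V h s = α * Real.log (Z h s))
    -- a trajectory: states `s`, actions `a`, observations `o`, consistent with `T`
    (s : ∀ h : Fin (N + 1), S h) (a : Fin (N + 1) → A) (o : Fin N → O)
    (htraj : ∀ h : Fin N, s h.succ = T h (s h.castSucc) (a h.castSucc) (o h)) :
    u (s (Fin.last N)) (a (Fin.last N)) =
      α * ∑ h : Fin (N + 1),
          Real.log (pol h (s h) (a h) / piRef h (s h) (a h) ^ (β / α))
      + V 0 (s 0)
      + ∑ h : Fin N,
          (V h.succ (s h.succ) -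
            ∑ o' : O, P h (s h.castSucc) (a h.castSucc) o' *
              V h.succ (T h (s h.castSucc) (a h.castSucc) o')) := by
  have hlog : ∀ h : Fin (N + 1),
      α * Real.log (pol h (s h) (a h) / piRef h (s h) (a h) ^ (β / α)) =
        Q h (s h) (a h) - V h (s h) := by
    intro h
    have hr : 0 < piRef h (s h) (a h) ^ (β / α) := Real.rpow_pos_of_pos (hrefpos _ _ _) _
    have hZpos : 0 < Z h (s h) := by
      rw [hZ]
      exact Finset.sum_pos
        (fun b _ => mul_pos (Real.rpow_pos_of_pos (hrefpos _ _ _) _) (Real.exp_pos _))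
        Finset.univ_nonempty
    have hratio : pol h (s h) (a h) / piRef h (s h) (a h) ^ (β / α) =
        Real.exp (Q h (s h) (a h) / α) / Z h (s h) := by
      rw [hpol]
      field_simp
    rw [hratio, Real.log_div (Real.exp_pos _).ne' hZpos.ne', Real.log_exp, hV]
    field_simp
  rw [Finset.mul_sum, Finset.sum_congr rfl fun h _ => hlog h, Finset.sum_sub_distrib,
    Fin.sum_univ_castSucc (fun h => Q h (s h) (a h)), Fin.sum_univ_succ (fun h => V h (s h)),
    hQlast, Finset.sum_sub_distrib, Finset.sum_congr rfl fun h _ => hQ h _ _]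
  ring
end

section
/- In the finite-horizon entropy-regularized setup with deterministic observations — i.e., there exist maps g_h : S_h × A → O such that P_h(·|s,a) is the point mass at g_h(s,a) for every h ≤ H−1 and (s,a) — the following holds for every trajectory (s_1, a_1, s_2, a_2, …, s_H, a_H) with s_{h+1} = T_h(s_h, a_h, g_h(s_h, a_h)): u(s_H, a_H) = α · Σ_{h=1}^{H} log( π_h(a_h|s_h) / π_ref,h(a_h|s_h)^{β/α} ) + V_1(s_1). -/
/-- The log-ratio of a Gibbs probability `w * exp (q / α) / z` to its base weight `w`. -/
theorem mul_log_gibbs_div_weight {α w q z : ℝ} (hα : α ≠ 0) (hw : w ≠ 0) (hz : z ≠ 0) :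
    α * Real.log (w * Real.exp (q / α) / z / w) = q - α * Real.log z := by
  have hratio : w * Real.exp (q / α) / z / w = Real.exp (q / α) / z := by
    field_simp
  rw [hratio, Real.log_div (Real.exp_ne_zero _) hz, Real.log_exp]
  field_simp

/-
Finite-horizon entropy-regularized setup with horizon `H = N + 1 ≥ 1`:
states `S h` for `h : Fin (N+1)`, actions `A`, observations `O`,
transitions `T`, observation kernels `P`, reference policies `piRef`,
terminal utility `u`, and the backward-induction quantities
`Q`, `Z`, `pol` (the optimal policy) and `V`, characterized by their
defining equations given as hypotheses.
-/
theorem stmt_12 {N : ℕ}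
    {S : Fin (N + 1) → Type*} [∀ h, Fintype (S h)] [∀ h, Nonempty (S h)]
    {A : Type*} [Fintype A] [Nonempty A]
    {O : Type*} [Fintype O] [Nonempty O]
    (T : ∀ h : Fin N, S h.castSucc → A → O → S h.succ)
    (P : ∀ h : Fin N, S h.castSucc → A → O → ℝ)
    (hPpos : ∀ h s a o, 0 ≤ P h s a o)
    (hPsum : ∀ h s a, ∑ o, P h s a o = 1)
    (piRef : ∀ h : Fin (N + 1), S h → A → ℝ)
    (hrefpos : ∀ h s a, 0 < piRef h s a)
    (hrefsum : ∀ h s, ∑ a, piRef h s a = 1)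
    (u : S (Fin.last N) → A → ℝ)
    (α β : ℝ) (hα : 0 < α) (hβ : 0 ≤ β)
    (Q : ∀ h : Fin (N + 1), S h → A → ℝ)
    (Z : ∀ h : Fin (N + 1), S h → ℝ)
    (pol : ∀ h : Fin (N + 1), S h → A → ℝ)
    (V : ∀ h : Fin (N + 1), S h → ℝ)
    (hQlast : ∀ s a, Q (Fin.last N) s a = u s a)
    (hQ : ∀ (h : Fin N) (s : S h.castSucc) (a : A),
      Q h.castSucc s a = ∑ o, P h s a o * V h.succ (T h s a o))
    (hZ : ∀ (h : Fin (N + 1)) (s : S h),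
      Z h s = ∑ a, piRef h s a ^ (β / α) * Real.exp (Q h s a / α))
    (hpol : ∀ (h : Fin (N + 1)) (s : S h) (a : A),
      pol h s a = piRef h s a ^ (β / α) * Real.exp (Q h s a / α) / Z h s)
    (hV : ∀ (h : Fin (N + 1)) (s : S h), V h s = α * Real.log (Z h s))
    [DecidableEq O]
    -- deterministic observations
    (g : ∀ h : Fin N, S h.castSucc → A → O)
    (hdet : ∀ (h : Fin N) (s : S h.castSucc) (a : A) (o' : O),
      P h s a o' = if o' = g h s a then 1 else 0)
    -- a trajectory consistent with the deterministic dynamics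
    (s : ∀ h : Fin (N + 1), S h) (a : Fin (N + 1) → A)
    (htraj : ∀ h : Fin N, s h.succ =
      T h (s h.castSucc) (a h.castSucc) (g h (s h.castSucc) (a h.castSucc))) :
    u (s (Fin.last N)) (a (Fin.last N)) =
      α * ∑ h : Fin (N + 1),
          Real.log (pol h (s h) (a h) / piRef h (s h) (a h) ^ (β / α))
      + V 0 (s 0) := by
  have hlog (h : Fin (N + 1)) :
      α * Real.log (pol h (s h) (a h) / piRef h (s h) (a h) ^ (β / α)) =
        Q h (s h) (a h) - V h (s h) := by
    rw [hpol, hV]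
    refine mul_log_gibbs_div_weight hα.ne' (Real.rpow_pos_of_pos (hrefpos _ _ _) _).ne' ?_
    rw [hZ]
    exact (Finset.sum_pos (fun b _ => mul_pos (Real.rpow_pos_of_pos (hrefpos _ _ _) _)
      (Real.exp_pos _)) Finset.univ_nonempty).ne'
  have hstep (h : Fin N) :
      Q h.castSucc (s h.castSucc) (a h.castSucc) = V h.succ (s h.succ) := by
    rw [hQ, htraj h]
    simp [hdet]
  rw [Finset.mul_sum, Finset.sum_congr rfl fun h _ => hlog h, Finset.sum_sub_distrib,
    Fin.sum_univ_castSucc, Fin.sum_univ_succ fun h => V h (s h),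
    Finset.sum_congr rfl fun h _ => hstep h, hQlast]
  ring
end

section
/- In the finite-horizon entropy-regularized setup with deterministic observations (maps g_h : S_h × A → O with P_h(·|s,a) the point mass at g_h(s,a)), fix an initial state s_1 ∈ S_1 and consider two trajectories τ⁺ = (s_1, a_1⁺, s_2⁺, …, s_H⁺, a_H⁺) and τ⁻ = (s_1, a_1⁻, s_2⁻, …, s_H⁻, a_H⁻), each satisfying s_{h+1} = T_h(s_h, a_h, g_h(s_h, a_h)). Then u(s_H⁺, a_H⁺) − u(s_H⁻, a_H⁻) = α · [ Σ_{h=1}^{H} log( π_h(a_h⁺|s_h⁺) / π_ref,h(a_h⁺|s_h⁺)^{β/α} ) − Σ_{h=1}^{H} log( π_h(a_h⁻|s_h⁻) / π_ref,h(a_h⁻|s_h⁻)^{β/α} ) ]. -/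
/-- Log-ratios of a Gibbs policy to its reference weights telescope along a trajectory on which
the action value equals the state value at the next step. -/
theorem mul_sum_log_gibbs_ratio {N : ℕ} (α : ℝ) (hα : α ≠ 0)
    (w q z p : Fin (N + 1) → ℝ) (hw : ∀ h, 0 < w h) (hz : ∀ h, 0 < z h)
    (hp : ∀ h, p h = w h * Real.exp (q h / α) / z h)
    (hstep : ∀ h : Fin N, q h.castSucc = α * Real.log (z h.succ)) :
    α * ∑ h, Real.log (p h / w h) = q (Fin.last N) - α * Real.log (z 0) := by
  have hlog : ∀ h, α * Real.log (p h / w h) = q h - α * Real.log (z h) := by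
    intro h
    have hratio : p h / w h = Real.exp (q h / α) / z h := by
      rw [hp]
      field_simp [(hw h).ne', (hz h).ne']
    rw [hratio, Real.log_div (Real.exp_ne_zero _) (hz h).ne', Real.log_exp, mul_sub,
      mul_div_cancel₀ _ hα]
  rw [Finset.mul_sum, Finset.sum_congr rfl fun h _ => hlog h, Finset.sum_sub_distrib,
    Fin.sum_univ_castSucc q, Fin.sum_univ_succ fun h => α * Real.log (z h),
    Finset.sum_congr rfl fun h _ => hstep h]
  ring

/-
Finite-horizon entropy-regularized setup with horizon `H = N + 1 ≥ 1`:
states `S h` for `h : Fin (N+1)`, actions `A`, observations `O`,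
transitions `T`, observation kernels `P`, reference policies `piRef`,
terminal utility `u`, and the backward-induction quantities
`Q`, `Z`, `pol` (the optimal policy) and `V`, characterized by their
defining equations given as hypotheses.
-/
theorem stmt_13 {N : ℕ}
    {S : Fin (N + 1) → Type*} [∀ h, Fintype (S h)] [∀ h, Nonempty (S h)]
    {A : Type*} [Fintype A] [Nonempty A]
    {O : Type*} [Fintype O] [Nonempty O]
    (T : ∀ h : Fin N, S h.castSucc → A → O → S h.succ)
    (P : ∀ h : Fin N, S h.castSucc → A → O → ℝ)
    (hPpos : ∀ h s a o, 0 ≤ P h s a o)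
    (hPsum : ∀ h s a, ∑ o, P h s a o = 1)
    (piRef : ∀ h : Fin (N + 1), S h → A → ℝ)
    (hrefpos : ∀ h s a, 0 < piRef h s a)
    (hrefsum : ∀ h s, ∑ a, piRef h s a = 1)
    (u : S (Fin.last N) → A → ℝ)
    (α β : ℝ) (hα : 0 < α) (hβ : 0 ≤ β)
    (Q : ∀ h : Fin (N + 1), S h → A → ℝ)
    (Z : ∀ h : Fin (N + 1), S h → ℝ)
    (pol : ∀ h : Fin (N + 1), S h → A → ℝ)
    (V : ∀ h : Fin (N + 1), S h → ℝ)
    (hQlast : ∀ s a, Q (Fin.last N) s a = u s a)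
    (hQ : ∀ (h : Fin N) (s : S h.castSucc) (a : A),
      Q h.castSucc s a = ∑ o, P h s a o * V h.succ (T h s a o))
    (hZ : ∀ (h : Fin (N + 1)) (s : S h),
      Z h s = ∑ a, piRef h s a ^ (β / α) * Real.exp (Q h s a / α))
    (hpol : ∀ (h : Fin (N + 1)) (s : S h) (a : A),
      pol h s a = piRef h s a ^ (β / α) * Real.exp (Q h s a / α) / Z h s)
    (hV : ∀ (h : Fin (N + 1)) (s : S h), V h s = α * Real.log (Z h s))
    [DecidableEq O]
    -- deterministic observations
    (g : ∀ h : Fin N, S h.castSucc → A → O)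
    (hdet : ∀ (h : Fin N) (s : S h.castSucc) (a : A) (o' : O),
      P h s a o' = if o' = g h s a then 1 else 0)
    -- two trajectories starting from the same initial state `s1`
    (s1 : S 0)
    (sp : ∀ h : Fin (N + 1), S h) (ap : Fin (N + 1) → A)
    (sm : ∀ h : Fin (N + 1), S h) (am : Fin (N + 1) → A)
    (hsp0 : sp 0 = s1) (hsm0 : sm 0 = s1)
    (htrajp : ∀ h : Fin N, sp h.succ =
      T h (sp h.castSucc) (ap h.castSucc) (g h (sp h.castSucc) (ap h.castSucc)))
    (htrajm : ∀ h : Fin N, sm h.succ =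
      T h (sm h.castSucc) (am h.castSucc) (g h (sm h.castSucc) (am h.castSucc))) :
    u (sp (Fin.last N)) (ap (Fin.last N)) - u (sm (Fin.last N)) (am (Fin.last N)) =
      α * (∑ h : Fin (N + 1),
            Real.log (pol h (sp h) (ap h) / piRef h (sp h) (ap h) ^ (β / α))
          - ∑ h : Fin (N + 1),
            Real.log (pol h (sm h) (am h) / piRef h (sm h) (am h) ^ (β / α))) := by
  have hw : ∀ h s a, 0 < piRef h s a ^ (β / α) := fun h s a =>
    Real.rpow_pos_of_pos (hrefpos h s a) _
  have hZpos : ∀ h s, 0 < Z h s := fun h s => by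
    rw [hZ]
    exact Finset.sum_pos (fun a _ => mul_pos (hw h s a) (Real.exp_pos _)) Finset.univ_nonempty
  have traj : ∀ (st : ∀ h, S h) (ac : Fin (N + 1) → A), (∀ h : Fin N, st h.succ =
      T h (st h.castSucc) (ac h.castSucc) (g h (st h.castSucc) (ac h.castSucc))) →
      α * ∑ h, Real.log (pol h (st h) (ac h) / piRef h (st h) (ac h) ^ (β / α)) =
        u (st (Fin.last N)) (ac (Fin.last N)) - α * Real.log (Z 0 (st 0)) := by
    intro st ac htraj
    rw [← hQlast]
    refine mul_sum_log_gibbs_ratio α hα.ne' (fun h => piRef h (st h) (ac h) ^ (β / α))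
      (fun h => Q h (st h) (ac h)) (fun h => Z h (st h)) (fun h => pol h (st h) (ac h))
      (fun h => hw h _ _) (fun h => hZpos h _) (fun h => hpol h _ _) fun h => ?_
    simp only [hQ, hdet, ite_mul, one_mul, zero_mul, Finset.sum_ite_eq',
      Finset.mem_univ, if_true]
    rw [← htraj, hV]
  rw [mul_sub, traj sp ap htrajp, traj sm am htrajm, hsp0, hsm0]
  ring
end
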